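/- arXiv:1711.02822 — 10 statements merged into one kernel-verified Lean document; each statement's English description precedes it below -/
import Mathlib

section
/- Let a, b, c be integers, not all zero, with D := b² − 4ac > 0, let Q be the matrix !![2a, b; b, 2c], and let k := gcd(a, b, c). Then a 2×2 integer matrix g satisfies det g = 1, gᵀ·Q·g = Q, and tr g > 0 if and only if there exist rational numbers u, v with u an integer, k·v an integer, u > 0, u² − D·v² = 4, and g = !![(u − b·v)/2, −c·v; a·v, (u + b·v)/2]. -/
open Matrix

/-- Proposition 2.2 (Proposition `PROP_generator_of_isometry`): for an even lattice
`Q = !![2a, b; b, 2c]` of signature `(1,1)` (i.e. `D = b² - 4ac > 0`), the elements of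
`SO⁺(Q)` (integer matrices `g` with `det g = 1`, `gᵀ·Q·g = Q` and `tr g > 0`) are exactly
the matrices `!![(u - bv)/2, -cv; av, (u + bv)/2]` for solutions `(u, v)` of the Pell
equation `u² - D v² = 4` with `u ∈ ℤ`, `k·v ∈ ℤ` (`k = gcd(a,b,c)`) and `u > 0`. -/
theorem stmt0 (a b c : ℤ) (hnz : ¬(a = 0 ∧ b = 0 ∧ c = 0))
    (D : ℤ) (hD : D = b ^ 2 - 4 * a * c) (hDpos : 0 < D)
    (Q : Matrix (Fin 2) (Fin 2) ℤ) (hQ : Q = !![2 * a, b; b, 2 * c])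
    (k : ℕ) (hk : k = Int.gcd a (Int.gcd b c))
    (g : Matrix (Fin 2) (Fin 2) ℤ) :
    (g.det = 1 ∧ gᵀ * Q * g = Q ∧ 0 < g.trace) ↔
      ∃ u v : ℚ, (∃ n : ℤ, u = n) ∧ (∃ n : ℤ, (k : ℚ) * v = n) ∧ 0 < u ∧
        u ^ 2 - (D : ℚ) * v ^ 2 = 4 ∧
        g.map (Int.cast : ℤ → ℚ) =
          !![(u - b * v) / 2, -c * v; a * v, (u + b * v) / 2] := by
  obtain ⟨x, y, z, hbez⟩ : ∃ x y z : ℤ, (k : ℤ) = a * x + b * y + c * z := by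
    refine ⟨Int.gcdA a (Int.gcd b c), Int.gcdB a (Int.gcd b c) * Int.gcdA b c,
      Int.gcdB a (Int.gcd b c) * Int.gcdB b c, ?_⟩
    rw [hk, Int.gcd_eq_gcd_ab]
    linear_combination Int.gcdB a (Int.gcd b c) * Int.gcd_eq_gcd_ab b c
  have hk0 : (k : ℚ) ≠ 0 := by
    intro h
    have h0 : k = 0 := by exact_mod_cast h
    rw [hk, Int.gcd_eq_zero_iff] at h0
    obtain ⟨ha, hbc⟩ := h0
    obtain ⟨hb, hc⟩ := Int.gcd_eq_zero_iff.mp (Int.natCast_eq_zero.mp hbc)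
    exact hnz ⟨ha, hb, hc⟩
  have hbezQ : (k : ℚ) = a * x + b * y + c * z := by exact_mod_cast hbez
  have hDQ : (D : ℚ) = b ^ 2 - 4 * a * c := by rw [hD]; push_cast; ring
  obtain ⟨p, q, r, s, rfl⟩ : ∃ p q r s, g = !![p, q; r, s] := ⟨_, _, _, _, eta_fin_two g⟩
  subst hQ
  simp only [← Matrix.ext_iff, Fin.forall_fin_two, det_fin_two, trace_fin_two, mul_apply,
    Fin.sum_univ_two, transpose_apply, map_apply, of_apply, cons_val', cons_val_zero,
    cons_val_one, cons_val_fin_one]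
  constructor
  · rintro ⟨hdet, ⟨⟨h₀₀, h₀₁⟩, h₁₀, h₁₁⟩, htr⟩
    have hab : a * (s - p) = b * r := by
      linarith [show 2 * (a * (s - p)) = 2 * (b * r) by
        linear_combination (-s) * h₀₀ + r * h₀₁ + (2 * a * p + b * r) * hdet]
    have hac : a * q = -c * r := by
      linarith [show 2 * (a * q) = 2 * (-c * r) by
        linear_combination s * h₀₁ - r * h₁₁ - (2 * a * q + b * s) * hdet]
    have hbc : c * (s - p) = -b * q := by
      linarith [show 2 * (c * (s - p)) = 2 * (-b * q) by
        linear_combination (-q) * h₀₁ + p * h₁₁ - (b * q + 2 * c * s) * hdet]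
    have hdetQ : (p : ℚ) * s - q * r = 1 := by exact_mod_cast hdet
    have habQ : (a : ℚ) * (s - p) = b * r := by exact_mod_cast hab
    have hacQ : (a : ℚ) * q = -c * r := by exact_mod_cast hac
    have hbcQ : (c : ℚ) * (s - p) = -b * q := by exact_mod_cast hbc
    obtain ⟨v, hv⟩ : ∃ v : ℚ, (k : ℚ) * v = x * r + y * (s - p) - z * q :=
      ⟨_, mul_div_cancel₀ _ hk0⟩
    have hav : (a : ℚ) * v = r := mul_left_cancel₀ hk0 <| by
      linear_combination a * hv - r * hbezQ + y * habQ - z * hacQ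
    have hbv : (b : ℚ) * v = s - p := mul_left_cancel₀ hk0 <| by
      linear_combination b * hv - (s - p) * hbezQ - x * habQ - z * hbcQ
    have hcv : (c : ℚ) * v = -q := mul_left_cancel₀ hk0 <| by
      linear_combination c * hv + q * hbezQ + x * hacQ + y * hbcQ
    refine ⟨p + s, v, ⟨p + s, by push_cast; rfl⟩, ⟨x * r + y * (s - p) - z * q, ?_⟩,
      by exact_mod_cast htr, ?_, ⟨?_, ?_⟩, ?_, ?_⟩
    · rw [hv]; push_cast; rfl
    · rw [hDQ]
      linear_combination 4 * hdetQ - (b * v + (s - p)) * hbv + 4 * (c * v) * hav + 4 * r * hcv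
    · linear_combination hbv / 2
    · linear_combination hcv
    · linear_combination -hav
    · linear_combination -hbv / 2
  · rintro ⟨u, v, -, -, hu, hpell, ⟨hp, hq⟩, hr, hs⟩
    rw [hDQ] at hpell
    refine ⟨?_, ⟨⟨?_, ?_⟩, ?_, ?_⟩, ?_⟩
    · have h : (p : ℚ) * s - q * r = 1 := by
        rw [hp, hq, hr, hs]
        linear_combination hpell / 4
      exact_mod_cast h
    · rw [← Int.cast_inj (α := ℚ)]
      push_cast
      rw [hp, hr]
      linear_combination a / 2 * hpell
    · rw [← Int.cast_inj (α := ℚ)]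
      push_cast
      rw [hp, hq, hr, hs]
      linear_combination b / 4 * hpell
    · rw [← Int.cast_inj (α := ℚ)]
      push_cast
      rw [hp, hq, hr, hs]
      linear_combination b / 4 * hpell
    · rw [← Int.cast_inj (α := ℚ)]
      push_cast
      rw [hq, hs]
      linear_combination c / 2 * hpell
    · have h : (0 : ℚ) < p + s := by
        rw [hp, hs]
        linarith
      exact_mod_cast h
end

section
/- Let a, b, c be integers with D := b² − 4ac > 0 and Q := !![2a, b; b, 2c]. The group {g ∈ M₂(ℤ) : det g = 1 and gᵀ·Q·g = Q} is infinite if and only if D is not a perfect square. -/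
open Matrix

/-- The matrix attached to the Pell solution `(x, y)` is an automorph of the form. -/
theorem automorph_of_pell {a b c x y : ℤ} (h : x ^ 2 - (b ^ 2 - 4 * a * c) * y ^ 2 = 1) :
    (!![x - b * y, -2 * c * y; 2 * a * y, x + b * y] : Matrix (Fin 2) (Fin 2) ℤ).det = 1 ∧
      !![x - b * y, -2 * c * y; 2 * a * y, x + b * y]ᵀ * !![2 * a, b; b, 2 * c] *
        !![x - b * y, -2 * c * y; 2 * a * y, x + b * y] = !![2 * a, b; b, 2 * c] := by
  refine ⟨by rw [det_fin_two_of]; linear_combination h, ?_⟩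
  ext i j
  fin_cases i <;> fin_cases j <;> simp [mul_apply, Fin.sum_univ_two]
  · linear_combination (2 * a) * h
  · linear_combination b * h
  · linear_combination b * h
  · linear_combination (2 * c) * h

/-- A special automorph satisfies linear relations between its entries. -/
theorem automorph_relations {a b c : ℤ} {g : Matrix (Fin 2) (Fin 2) ℤ} (hdet : g.det = 1)
    (hg : gᵀ * !![2 * a, b; b, 2 * c] * g = !![2 * a, b; b, 2 * c]) :
    a * (g 0 0 - g 1 1) = -b * g 1 0 ∧ a * g 0 1 = -c * g 1 0 ∧
      b * g 0 1 = c * (g 0 0 - g 1 1) := by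
  have h00 := congrFun (congrFun hg 0) 0
  have h01 := congrFun (congrFun hg 0) 1
  have h10 := congrFun (congrFun hg 1) 0
  have h11 := congrFun (congrFun hg 1) 1
  simp [mul_apply, Fin.sum_univ_two] at h00 h01 h10 h11
  rw [det_fin_two] at hdet
  generalize g 0 0 = p at *
  generalize g 0 1 = q at *
  generalize g 1 0 = r at *
  generalize g 1 1 = s at *
  have e1 : 2 * (a * (p - s)) = 2 * (-b * r) := by
    linear_combination s * h00 - r * h01 - (2 * a * p + b * r) * hdet
  have e2 : 2 * (a * q) = 2 * (-c * r) := by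
    linear_combination s * h01 - r * h11 - (2 * a * q + b * s) * hdet
  have e3 : 2 * (b * q) = 2 * (c * (p - s)) := by
    linear_combination p * h11 - q * h01 - (b * q + 2 * c * s) * hdet
  exact ⟨by linarith, by linarith, by linarith⟩

/-- If the product of `u - v` and `u + v` is a nonzero integer `m`, then `|u|, |v| ≤ |m|`. -/
theorem abs_le_of_sub_mul_add_eq {u v m : ℤ} (hm : m ≠ 0) (h : (u - v) * (u + v) = m) :
    |u| ≤ |m| ∧ |v| ≤ |m| := by
  have h1 : |u - v| ≤ |m| :=
    Int.le_of_dvd (abs_pos.2 hm) ((abs_dvd_abs _ _).2 ⟨_, h.symm⟩)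
  have h2 : |u + v| ≤ |m| :=
    Int.le_of_dvd (abs_pos.2 hm) ((abs_dvd_abs _ _).2 ⟨u - v, by rw [← h, mul_comm]⟩)
  rw [abs_le] at h1 h2
  constructor <;> rw [abs_le] <;> constructor <;> linarith

/-- A form of nonzero square discriminant has only finitely many special automorphs. -/
theorem finite_automorphs_of_isSquare {a b c : ℤ} (hD : 0 < b ^ 2 - 4 * a * c)
    (hsq : IsSquare (b ^ 2 - 4 * a * c)) :
    {g : Matrix (Fin 2) (Fin 2) ℤ | g.det = 1 ∧
      gᵀ * !![2 * a, b; b, 2 * c] * g = !![2 * a, b; b, 2 * c]}.Finite := by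
  obtain ⟨k, hk⟩ := hsq
  have hk0 : k ≠ 0 := by rintro rfl; simp [hk] at hD
  by_cases ha : a = 0
  · subst ha
    have hb : b ≠ 0 := by rintro rfl; simp at hD
    refine (Set.toFinite {1, -1}).subset ?_
    rintro g ⟨hdet, hg⟩
    obtain ⟨h1, -, h3⟩ := automorph_relations hdet hg
    have hr : g 1 0 = 0 := by simpa [hb] using h1
    rw [det_fin_two, hr, mul_zero, sub_zero] at hdet
    rcases Int.mul_eq_one_iff_eq_one_or_neg_one.1 hdet with ⟨hp, hs⟩ | ⟨hp, hs⟩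
    all_goals
      have hq : g 0 1 = 0 := by simpa [hb, hp, hs] using h3
    · left
      ext i j
      fin_cases i <;> fin_cases j <;> simp [*]
    · right
      ext i j
      fin_cases i <;> fin_cases j <;> simp [*]
  · have hm : 4 * a ^ 2 ≠ 0 := by positivity
    refine Set.Finite.of_finite_image (f := fun g => (g 0 0 + g 1 1, g 1 0))
      (((Set.finite_Icc (-|4 * a ^ 2|) |4 * a ^ 2|).prod
        (Set.finite_Icc (-|4 * a ^ 2|) |4 * a ^ 2|)).subset ?_) ?_
    · rintro _ ⟨g, ⟨hdet, hg⟩, rfl⟩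
      obtain ⟨h1, h2, -⟩ := automorph_relations hdet hg
      rw [det_fin_two] at hdet
      have key : (a * (g 0 0 + g 1 1) - k * g 1 0) * (a * (g 0 0 + g 1 1) + k * g 1 0)
          = 4 * a ^ 2 := by
        linear_combination (4 * a ^ 2) * hdet + (g 1 0) ^ 2 * hk +
          (a * (g 0 0 - g 1 1) - b * g 1 0) * h1 + 4 * a * g 1 0 * h2
      obtain ⟨hu, hv⟩ := abs_le_of_sub_mul_add_eq hm key
      rw [abs_mul] at hu hv
      have ha1 : 1 ≤ |a| := Int.one_le_abs ha
      have hk1 : 1 ≤ |k| := Int.one_le_abs hk0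
      exact ⟨abs_le.1 ((le_mul_of_one_le_left (abs_nonneg _) ha1).trans hu),
        abs_le.1 ((le_mul_of_one_le_left (abs_nonneg _) hk1).trans hv)⟩
    · rintro g ⟨hdet, hg⟩ g' ⟨hdet', hg'⟩ heq
      obtain ⟨h1, h2, -⟩ := automorph_relations hdet hg
      obtain ⟨h1', h2', -⟩ := automorph_relations hdet' hg'
      obtain ⟨ht, hr⟩ := Prod.mk.inj heq
      have hq : g 0 1 = g' 0 1 := mul_left_cancel₀ ha (by rw [h2, h2', hr])
      have he : g 0 0 - g 1 1 = g' 0 0 - g' 1 1 := mul_left_cancel₀ ha (by rw [h1, h1', hr])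
      ext i j
      fin_cases i <;> fin_cases j <;> simp <;> linarith

/-- A form of positive nonsquare discriminant has infinitely many special automorphs. -/
theorem infinite_automorphs_of_not_isSquare {a b c : ℤ} (hD : 0 < b ^ 2 - 4 * a * c)
    (hsq : ¬ IsSquare (b ^ 2 - 4 * a * c)) :
    {g : Matrix (Fin 2) (Fin 2) ℤ | g.det = 1 ∧
      gᵀ * !![2 * a, b; b, 2 * c] * g = !![2 * a, b; b, 2 * c]}.Infinite := by
  have ha : a ≠ 0 := by
    rintro rfl
    exact hsq ⟨b, by ring⟩
  obtain ⟨f, hf⟩ := Pell.IsFundamental.exists_of_not_isSquare hD hsq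
  refine Set.infinite_of_injective_forall_mem
    (f := fun n : ℤ => !![(f ^ n).x - b * (f ^ n).y, -2 * c * (f ^ n).y;
      2 * a * (f ^ n).y, (f ^ n).x + b * (f ^ n).y]) ?_ fun n => automorph_of_pell (f ^ n).prop
  intro m n hmn
  have h := congrFun (congrFun hmn 1) 0
  refine hf.y_strictMono.injective ?_
  simpa [ha] using h

/-- The special orthogonal group of an even binary lattice of signature `(1,1)` is
infinite if and only if `D = b² - 4ac` is not a perfect square. -/
theorem stmt1 (a b c : ℤ) (D : ℤ) (hD : D = b ^ 2 - 4 * a * c) (hDpos : 0 < D)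
    (Q : Matrix (Fin 2) (Fin 2) ℤ) (hQ : Q = !![2 * a, b; b, 2 * c]) :
    {g : Matrix (Fin 2) (Fin 2) ℤ | g.det = 1 ∧ gᵀ * Q * g = Q}.Infinite ↔
      ¬ IsSquare D := by
  subst hD hQ
  exact ⟨fun h hsq => h (finite_automorphs_of_isSquare hDpos hsq),
    infinite_automorphs_of_not_isSquare hDpos⟩
end

section
/- Let a, b, c be integers with D := b² − 4ac > 0. Then D is a perfect square if and only if there exist integers (x, y) ≠ (0, 0) with a·x² + b·x·y + c·y² = 0. -/
/-- For an indefinite binary quadratic form, `D = b² - 4ac` is a perfect square if and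
only if the form represents `0` nontrivially. -/
theorem stmt2 (a b c : ℤ) (D : ℤ) (hD : D = b ^ 2 - 4 * a * c) (hDpos : 0 < D) :
    IsSquare D ↔
      ∃ x y : ℤ, (x, y) ≠ (0, 0) ∧ a * x ^ 2 + b * x * y + c * y ^ 2 = 0 := by
  subst hD
  constructor
  · rintro ⟨s, hs⟩
    by_cases ha : a = 0
    · exact ⟨1, 0, by simp, by simp [ha]⟩
    · refine ⟨s - b, 2 * a, by simp [ha], ?_⟩
      linear_combination -a * hs
  · rintro ⟨x, y, hxy, h⟩
    by_cases hy : y = 0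
    · subst hy
      have hx : x ≠ 0 := by simpa using hxy
      have ha : a = 0 := by simpa [hx] using h
      exact ⟨b, by rw [ha]; ring⟩
    · have key : (2 * a * x + b * y) ^ 2 = (b ^ 2 - 4 * a * c) * y ^ 2 := by
        linear_combination 4 * a * h
      obtain ⟨k, hk⟩ : y ∣ 2 * a * x + b * y :=
        (Int.pow_dvd_pow_iff two_ne_zero).mp (key ▸ Dvd.intro_left _ rfl)
      refine ⟨k, mul_right_cancel₀ (pow_ne_zero 2 hy) ?_⟩
      rw [← key, hk]
      ring
end

section
/- Let a, b, c be integers with D := b² − 4ac > 0, let Q := !![2a, b; b, 2c], and let ε ∈ {1, −1}. Let u, v be rational numbers with u an integer, u > 2, and u² − D·v² = 4, and suppose the matrix g := !![(u − b·v)/2, −c·v; a·v, (u + b·v)/2] has integer entries. Then every entry of the rational matrix (g − ε·I₂)·Q⁻¹ is an integer if and only if there exist nonzero integers α, β with u = α² − 2ε, v = α·β, and α² − D·β² = 4ε. -/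
open Matrix

/-- If `t * s` is a square, `t * D = s - 4 * ε` with `ε = ±1`, and `D` is a discriminant, then
`s` and `t` are themselves squares. -/
theorem exists_sq_of_mul_eq_sq {s t v a b c ε : ℤ} (hε : ε = 1 ∨ ε = -1) (ht : 0 < t)
    (hts : t * s = v ^ 2) (hD : t * (b ^ 2 - 4 * a * c) = s - 4 * ε) :
    ∃ α β : ℤ, s = α ^ 2 ∧ t = β ^ 2 ∧ v = α * β := by
  obtain ⟨d, x, hdx, hd⟩ := Nat.sq_mul_squarefree t.toNat
  have htx : t = (x : ℤ) ^ 2 * d := by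
    rw [← Int.toNat_of_nonneg ht.le, ← hdx]; push_cast; ring
  have hx0 : (x : ℤ) ≠ 0 := by rintro h; simp [h] at htx; omega
  have hd0 : (d : ℤ) ≠ 0 := by rintro h; simp [h] at htx; omega
  have hdsq : Squarefree (d : ℤ) := Int.squarefree_natCast.mpr hd
  obtain ⟨w, hw⟩ : (x : ℤ) ∣ v :=
    (Int.pow_dvd_pow_iff two_ne_zero).mp ⟨d * s, by rw [← hts, htx]; ring⟩
  have hdsw : (d : ℤ) * s = w ^ 2 := by
    apply mul_left_cancel₀ (pow_ne_zero 2 hx0)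
    rw [← mul_assoc, ← htx, hts, hw]; ring
  obtain ⟨y, hy⟩ : (d : ℤ) ∣ w := (hdsq.dvd_pow_iff_dvd two_ne_zero).mp ⟨s, hdsw.symm⟩
  have hs : s = d * y ^ 2 := by
    apply mul_left_cancel₀ hd0
    rw [hdsw, hy]; ring
  have hdvd : (d : ℤ) ∣ 4 := by
    have h : (d : ℤ) ∣ 4 * ε :=
      ⟨y ^ 2 - (x : ℤ) ^ 2 * (b ^ 2 - 4 * a * c), by rw [htx, hs] at hD; linear_combination hD⟩
    rcases hε with rfl | rfl <;> simpa using h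
  have hdvd' : d ∣ 4 := by exact_mod_cast hdvd
  have hle : d ≤ 4 := Nat.le_of_dvd (by norm_num) hdvd'
  have hd12 : d = 1 ∨ d = 2 := by
    have h4 : d ≠ 4 := by
      rintro rfl
      have := hd 2 (by norm_num)
      simp at this
    have h3 : d ≠ 3 := by rintro rfl; omega
    have h0 : d ≠ 0 := by exact_mod_cast hd0
    omega
  rcases hd12 with rfl | rfl
  · exact ⟨y, x, by simpa using hs, by simpa using htx, by rw [hw, hy]; push_cast; ring⟩
  · exfalso
    have key : (x * b : ℤ) ^ 2 - y ^ 2 = 4 * (x ^ 2 * (a * c)) - 2 * ε := by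
      rw [htx, hs] at hD
      push_cast at hD
      linarith
    generalize (x : ℤ) ^ 2 * (a * c) = k at key
    rcases Int.even_or_odd' (x * b : ℤ) with ⟨m, hm | hm⟩ <;>
    rcases Int.even_or_odd' y with ⟨n, hn | hn⟩ <;>
    rw [hm, hn] at key <;> ring_nf at key <;> omega

/-- Lemma 4.4 (`LEM_disc_triv`): a nontrivial isometry `g ∈ SO⁺(L)` acts on the
discriminant group as `ε·id` (i.e. `(g - ε·I₂)·Q⁻¹` is an integer matrix) if and only if
`(u, v) = (α² - 2ε, αβ)` with `α² - Dβ² = 4ε` for some nonzero integers `α, β`. -/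
theorem stmt3 (a b c : ℤ) (D : ℤ) (hD : D = b ^ 2 - 4 * a * c) (hDpos : 0 < D)
    (ε : ℤ) (hε : ε = 1 ∨ ε = -1)
    (u v : ℚ) (hu : ∃ n : ℤ, u = n) (hu2 : 2 < u)
    (hpell : u ^ 2 - (D : ℚ) * v ^ 2 = 4)
    (g : Matrix (Fin 2) (Fin 2) ℚ)
    (hg : g = !![(u - b * v) / 2, -c * v; a * v, (u + b * v) / 2])
    (hgint : ∀ i j, ∃ n : ℤ, g i j = n)
    (Q : Matrix (Fin 2) (Fin 2) ℚ) (hQ : Q = !![2 * (a : ℚ), (b : ℚ); (b : ℚ), 2 * (c : ℚ)]) :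
    (∀ i j, ∃ n : ℤ, ((g - (ε : ℚ) • (1 : Matrix (Fin 2) (Fin 2) ℚ)) * Q⁻¹) i j = n) ↔
      ∃ α β : ℤ, α ≠ 0 ∧ β ≠ 0 ∧ u = (α : ℚ) ^ 2 - 2 * ε ∧ v = (α : ℚ) * β ∧
        α ^ 2 - D * β ^ 2 = 4 * ε := by
  have hD0 : (D : ℚ) ≠ 0 := by exact_mod_cast hDpos.ne'
  have hDq : (D : ℚ) = b ^ 2 - 4 * a * c := by exact_mod_cast hD
  have hε2 : (ε : ℚ) ^ 2 = 1 := by rcases hε with rfl | rfl <;> norm_num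
  obtain ⟨t, ht⟩ : ∃ t : ℚ, t * D = u - 2 * ε := ⟨(u - 2 * ε) / D, by field_simp⟩
  have hM : (g - (ε : ℚ) • (1 : Matrix (Fin 2) (Fin 2) ℚ)) * Q⁻¹ =
      !![-(t * c), (t * b - v) / 2; (t * b + v) / 2, -(t * a)] := by
    have hdet : IsUnit Q.det := by
      rw [hQ, det_fin_two_of, isUnit_iff_ne_zero]
      intro h
      exact hD0 (by rw [hDq]; linarith)
    have hmul : g - (ε : ℚ) • (1 : Matrix (Fin 2) (Fin 2) ℚ) =
        !![-(t * c), (t * b - v) / 2; (t * b + v) / 2, -(t * a)] * Q := by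
      rw [hDq] at ht
      rw [hg, hQ]
      ext i j
      fin_cases i <;> fin_cases j <;> simp [mul_apply, Fin.sum_univ_two]
      · linear_combination -ht / 2
      · ring
      · ring
      · linear_combination -ht / 2
    rw [hmul, mul_nonsing_inv_cancel_right _ _ hdet]
  have hts : t * (u + 2 * ε) = v ^ 2 := by
    apply mul_left_cancel₀ hD0
    linear_combination (u + 2 * ε) * ht + hpell - 4 * hε2
  rw [hM]
  constructor
  · intro h
    obtain ⟨r, hr⟩ := h 0 0
    obtain ⟨p, hp⟩ := h 0 1
    obtain ⟨q, hq⟩ := h 1 0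
    obtain ⟨w, hw⟩ := h 1 1
    simp only [of_apply, cons_val', cons_val_zero, cons_val_one, cons_val_fin_one] at hr hp hq hw
    obtain ⟨n, rfl⟩ := hu
    have htq : t = ((ε * (r * w - p * q) : ℤ) : ℚ) := by
      push_cast
      rw [← hr, ← hp, ← hq, ← hw]
      rw [hDq] at ht
      linear_combination (-t) * hε2 + (ε * t / 4) * ht + (ε / 4) * hts
    have hvq : v = ((q - p : ℤ) : ℚ) := by
      push_cast
      rw [← hp, ← hq]
      ring
    generalize ε * (r * w - p * q) = T at htq
    generalize q - p = V at hvq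
    subst htq hvq
    have hε' : (-1 : ℚ) ≤ ε ∧ (ε : ℚ) ≤ 1 := by rcases hε with rfl | rfl <;> norm_num
    have hTpos : 0 < T := by
      have hDp : (0 : ℚ) < D := by exact_mod_cast hDpos
      have : (0 : ℚ) < T * D := by rw [ht]; linarith
      exact_mod_cast pos_of_mul_pos_left this hDp.le
    have hts' : T * (n + 2 * ε) = V ^ 2 := by exact_mod_cast hts
    have ht' : T * D = n - 2 * ε := by exact_mod_cast ht
    obtain ⟨α, β, hα, hβ, hαβ⟩ := exists_sq_of_mul_eq_sq hε hTpos hts'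
      (by rw [← hD, ht']; ring)
    have hspos : 0 < n + 2 * ε := by
      have : (0 : ℚ) < n + 2 * ε := by linarith
      exact_mod_cast this
    refine ⟨α, β, ?_, ?_, ?_, by exact_mod_cast hαβ, ?_⟩
    · rintro rfl; simp at hα; omega
    · rintro rfl; simp at hβ; omega
    · have : n = α ^ 2 - 2 * ε := by linarith
      exact_mod_cast this
    · rw [← hα, ← hβ]; linear_combination -ht'
  · rintro ⟨α, β, -, -, hu', hv', hαβ⟩
    have hαβq : (α : ℚ) ^ 2 - D * β ^ 2 = 4 * ε := by exact_mod_cast hαβ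
    obtain rfl : t = (β : ℚ) ^ 2 := by
      apply mul_right_cancel₀ hD0
      rw [ht, hu']
      linear_combination hαβq
    obtain ⟨k, hk⟩ : ∃ k, β * b - α = 2 * k := by
      have h : Even ((β * b - α) ^ 2) :=
        ⟨2 * (β ^ 2 * (a * c)) - 2 * ε - α * (β * b - α), by
          rw [hD] at hαβ; linear_combination -hαβ⟩
      exact ((Int.even_pow' two_ne_zero).mp h).two_dvd
    have hkq : (β : ℚ) * b - α = 2 * k := by exact_mod_cast hk
    intro i j
    fin_cases i <;> fin_cases j <;> simp
    · exact ⟨-(β ^ 2 * c), by push_cast; ring⟩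
    · exact ⟨β * k, by rw [hv']; push_cast; linear_combination (β / 2 : ℚ) * hkq⟩
    · exact ⟨β * (k + α), by rw [hv']; push_cast; linear_combination (β / 2 : ℚ) * hkq⟩
    · exact ⟨-(β ^ 2 * a), by push_cast; ring⟩
end

section
/- Let D be an integer with D ≡ 0 (mod 4) or D ≡ 1 (mod 4), let ε ∈ {1, −1}, let m be a positive integer, and let v be an integer with v² = m·(m·D + 4ε). Then m is a perfect square. -/
theorem isSquare_of_pos_of_isCoprime_of_mul_eq_sq {a b c : ℤ} (ha : 0 < a)
    (hab : IsCoprime a b) (h : a * b = c ^ 2) : IsSquare a := by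
  obtain ⟨d, hd | hd⟩ := Int.sq_of_isCoprime hab h
  · exact ⟨d, by rw [hd, sq]⟩
  · nlinarith [sq_nonneg d]

/-- The Claim in the proof of Lemma 4.4: if `D ≡ 0, 1 (mod 4)`, `ε = ±1`, `m > 0` and
`v² = m(mD + 4ε)` for some integer `v`, then `m` is a perfect square. -/
theorem stmt4 (D : ℤ) (hD : D % 4 = 0 ∨ D % 4 = 1)
    (ε : ℤ) (hε : ε = 1 ∨ ε = -1)
    (m : ℤ) (hm : 0 < m) (v : ℤ) (hv : v ^ 2 = m * (m * D + 4 * ε)) :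
    IsSquare m := by
  have hε2 : ε * ε = 1 := by rcases hε with rfl | rfl <;> norm_num
  have two_dvd_of_sq {x y : ℤ} (h : x ^ 2 = 2 * y) : (2 : ℤ) ∣ x :=
    Int.prime_two.dvd_of_dvd_pow ⟨y, h⟩
  rcases Int.even_or_odd' m with ⟨k, rfl | rfl⟩
  · obtain ⟨w, rfl⟩ := two_dvd_of_sq (y := k * (2 * k * D + 4 * ε)) (by rw [hv]; ring)
    have hw : k * (k * D + 2 * ε) = w ^ 2 := by linarith
    rcases Int.even_or_odd' k with ⟨l, rfl | rfl⟩
    · obtain ⟨u, rfl⟩ := two_dvd_of_sq (y := l * (2 * l * D + 2 * ε)) (by rw [← hw]; ring)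
      have hu : l * (l * D + ε) = u ^ 2 := by linarith
      obtain ⟨s, rfl⟩ := isSquare_of_pos_of_isCoprime_of_mul_eq_sq (by lia)
        ⟨-D * ε, ε, by linear_combination hε2⟩ hu
      exact ⟨2 * s, by ring⟩
    · obtain ⟨s, hs⟩ := isSquare_of_pos_of_isCoprime_of_mul_eq_sq (by lia)
        ⟨1 + l * D * ε, -l * ε, by linear_combination (-2 * l) * hε2⟩ hw
      exfalso
      have hk : (2 * l + 1) % 4 = 1 := by
        rcases Int.even_or_odd' s with ⟨t, rfl | rfl⟩
        · have : 2 * l + 1 = 2 * (2 * (t * t)) := by rw [hs]; ring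
          lia
        · have : 2 * l + 1 = 4 * (t * t + t) + 1 := by rw [hs]; ring
          lia
      obtain ⟨n, rfl⟩ : ∃ n, l = 2 * n := ⟨l / 2, by lia⟩
      have hmod : w ^ 2 = 4 * (4 * n * n * D + 2 * n * D + 2 * n * ε) + D + 2 * ε := by
        rw [← hw]; ring
      have hsq : w ^ 2 % 4 = 0 ∨ w ^ 2 % 4 = 1 := by
        rcases Int.even_or_odd' w with ⟨t, rfl | rfl⟩
        · left; ring_nf; lia
        · right; ring_nf; lia
      lia
  · refine isSquare_of_pos_of_isCoprime_of_mul_eq_sq hm ?_ hv.symm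
    have h4 : IsCoprime (2 * k + 1) (4 * ε) :=
      ⟨1 - 2 * k, k ^ 2 * ε, by linear_combination 4 * k ^ 2 * hε2⟩
    simpa [add_comm] using h4.add_mul_left_right D
end

section
/- Let α be an integer with α ≥ 4. Then for all integers (x, y) ≠ (0, 0), the value 2x² + 2αxy + 2y² is neither 0 nor −2. (That is, the even binary lattice !![2, α; α, 2], which has discriminant −(α² − 4), represents neither 0 nor −2 nontrivially.) -/
/-- Vieta descent: the form `x² - αxy + y²` with `4 ≤ α` takes neither of the values `0`, `-1`
at positive integers `y ≤ x`. -/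
theorem sq_sub_mul_add_sq_ne_neg {α n : ℤ} (hα : 4 ≤ α) (hn₀ : 0 ≤ n) (hn₁ : n ≤ 1)
    (N : ℕ) (x y : ℤ) (hxN : x ≤ N) (hy : 0 < y) (hyx : y ≤ x) :
    x ^ 2 - α * x * y + y ^ 2 ≠ -n := by
  induction N generalizing x y with
  | zero => push_cast at hxN; omega
  | succ N ih =>
    intro h
    push_cast at hxN
    rcases hyx.eq_or_lt with rfl | hlt
    · nlinarith [mul_nonneg (sub_nonneg.2 hα) (sq_nonneg y)]
    · have hprod : x * (α * y - x) = y ^ 2 + n := by linarith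
      have hpos : 0 < α * y - x := by
        by_contra! hle
        nlinarith
      have hle : α * y - x ≤ y := by
        by_contra! hgt
        nlinarith
      exact ih y (α * y - x) (by omega) hpos hle (by linarith)

/-- The form `x² + αxy + y²` with `4 ≤ α` takes neither of the values `0`, `-1` nontrivially. -/
theorem sq_add_mul_add_sq_ne_neg {α n : ℤ} (hα : 4 ≤ α) (hn₀ : 0 ≤ n) (hn₁ : n ≤ 1)
    {x y : ℤ} (hxy : (x, y) ≠ (0, 0)) : x ^ 2 + α * x * y + y ^ 2 ≠ -n := by
  intro h
  have hneg : x * y < 0 := by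
    by_contra! hnonneg
    have hmul := mul_nonneg (by linarith : (0 : ℤ) ≤ α) hnonneg
    have hx : x ^ 2 = 0 := by nlinarith [sq_nonneg x, sq_nonneg y]
    have hy : y ^ 2 = 0 := by nlinarith [sq_nonneg x, sq_nonneg y]
    exact hxy (by simp_all)
  have descend (u v : ℤ) (hu : 0 < u) (hv : 0 < v) (huv : u ^ 2 - α * u * v + v ^ 2 = -n) :
      False := by
    rcases le_total v u with hle | hle
    · exact sq_sub_mul_add_sq_ne_neg hα hn₀ hn₁ u.toNat u v u.self_le_toNat hv hle huv
    · exact sq_sub_mul_add_sq_ne_neg hα hn₀ hn₁ v.toNat v u v.self_le_toNat hu hle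
        (by linarith)
  rcases mul_neg_iff.1 hneg with ⟨hx, hy⟩ | ⟨hx, hy⟩
  · exact descend x (-y) hx (neg_pos.2 hy) (by linarith)
  · exact descend (-x) y (neg_pos.2 hx) hy (by linarith)

/-- Symplectic case: for `α ≥ 4`, the even lattice `!![2, α; α, 2]` of discriminant
`-(α² - 4)` represents neither `0` nor `-2` nontrivially, i.e. it lies in `𝕃′`. -/
theorem stmt5 (α : ℤ) (hα : 4 ≤ α) (x y : ℤ) (hxy : (x, y) ≠ (0, 0)) :
    2 * x ^ 2 + 2 * α * x * y + 2 * y ^ 2 ≠ 0 ∧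
      2 * x ^ 2 + 2 * α * x * y + 2 * y ^ 2 ≠ -2 := by
  constructor
  · intro h
    exact sq_add_mul_add_sq_ne_neg hα le_rfl zero_le_one hxy (by linarith)
  · intro h
    exact sq_add_mul_add_sq_ne_neg hα zero_le_one le_rfl hxy (by linarith)
end

section
/- Let a, b, c be integers with b² − 4ac = 5. Then there exist integers x, y with 2a·x² + 2b·x·y + 2c·y² = −2. (Every even binary lattice of discriminant −5 represents −2.) -/
/-- Gauss reduction: an integral binary quadratic form of discriminant `5` represents `-1`. -/
theorem exists_eq_neg_one_of_discr_eq_five (n : ℕ) (a b c : ℤ) (hn : a.natAbs = n)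
    (hD : b ^ 2 - 4 * a * c = 5) :
    ∃ x y : ℤ, a * x ^ 2 + b * x * y + c * y ^ 2 = -1 := by
  induction n using Nat.strong_induction_on generalizing a b c with
  | _ n ih =>
  have ha : a ≠ 0 := by
    rintro rfl
    have h3 : b < 3 := by nlinarith
    have h3' : -3 < b := by nlinarith
    interval_cases b <;> omega
  obtain ⟨k, hk⟩ : ∃ k : ℤ, |b + 2 * a * k| ≤ |a| := by
    refine ⟨-((b + |a|) / (2 * a)), ?_⟩
    have h0 := Int.emod_nonneg (b + |a|) (b := 2 * a) (by omega)
    have h1 := Int.emod_lt_abs (b + |a|) (b := 2 * a) (by omega)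
    rw [abs_mul, abs_two] at h1
    rw [Int.emod_def] at h0 h1
    rw [abs_le]
    constructor <;> linarith
  obtain ⟨d, hd⟩ : ∃ d, d = b + 2 * a * k := ⟨_, rfl⟩
  obtain ⟨e, he⟩ : ∃ e, e = a * k ^ 2 + b * k + c := ⟨_, rfl⟩
  rw [← hd] at hk
  have hD' : d ^ 2 - 4 * a * e = 5 := by rw [hd, he]; linear_combination hD
  -- it suffices to represent `-1` by the translated form `(a, d, e)`
  suffices h : ∃ x y : ℤ, a * x ^ 2 + d * x * y + e * y ^ 2 = -1 by
    obtain ⟨x, y, h⟩ := h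
    exact ⟨x + k * y, y, by rw [hd, he] at h; linear_combination h⟩
  by_cases h5 : d ^ 2 < 5
  · have h3 : d < 3 := by nlinarith
    have h3' : -3 < d := by nlinarith
    have hae : a * e = -1 := by
      have h4 : d ^ 2 - 4 * (a * e) = 5 := by linear_combination hD'
      interval_cases d <;> omega
    rcases Int.eq_one_or_neg_one_of_mul_eq_neg_one hae with rfl | rfl
    · exact ⟨0, 1, by linarith⟩
    · exact ⟨1, 0, by ring⟩
  · have hlt : |e| < |a| := by
      have hd2 : d ^ 2 ≤ |a| ^ 2 := sq_le_sq.mpr (by rwa [abs_abs])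
      have h4 : 4 * (|a| * |e|) = d ^ 2 - 5 := by
        rw [← abs_mul, abs_of_nonneg (by linarith)]
        linear_combination -hD'
      have := abs_pos.mpr ha
      nlinarith
    rw [Int.abs_eq_natAbs, Int.abs_eq_natAbs] at hlt
    obtain ⟨x, y, h⟩ := ih e.natAbs (by omega) e d a rfl (by linear_combination hD')
    exact ⟨y, x, by linear_combination h⟩

/-- Every even binary lattice of discriminant `-5` represents `-2`. -/
theorem stmt6 (a b c : ℤ) (hD : b ^ 2 - 4 * a * c = 5) :
    ∃ x y : ℤ, 2 * a * x ^ 2 + 2 * b * x * y + 2 * c * y ^ 2 = -2 := by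
  obtain ⟨x, y, h⟩ := exists_eq_neg_one_of_discr_eq_five _ a b c rfl hD
  exact ⟨x, y, by linear_combination 2 * h⟩
end

section
/- Let a, b, c be integers with b² − 4ac = 8. Then there exist integers x, y with 2a·x² + 2b·x·y + 2c·y² = −2. (Every even binary lattice of discriminant −8 represents −2.) -/
/-- An integral form `a x² + 2k xy + c y²` with `k² - ac = 2` represents `-1`. -/
theorem represents_neg_one_of_sq_sub_mul_eq_two (a k c : ℤ) (h : k ^ 2 - a * c = 2) :
    ∃ x y : ℤ, a * x ^ 2 + 2 * k * x * y + c * y ^ 2 = -1 := by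
  induction hn : k.natAbs using Nat.strong_induction_on generalizing a k c with
  | _ n ih =>
  subst hn
  have shift_left (t : ℤ) (ht : (k + t * a).natAbs < k.natAbs) :
      ∃ x y : ℤ, a * x ^ 2 + 2 * k * x * y + c * y ^ 2 = -1 := by
    obtain ⟨x, y, hxy⟩ := ih _ ht a (k + t * a) (a * t ^ 2 + 2 * k * t + c)
      (by linear_combination h) rfl
    exact ⟨x + t * y, y, by linear_combination hxy⟩
  have shift_right (t : ℤ) (ht : (k + t * c).natAbs < k.natAbs) :
      ∃ x y : ℤ, a * x ^ 2 + 2 * k * x * y + c * y ^ 2 = -1 := by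
    obtain ⟨x, y, hxy⟩ := ih _ ht (c * t ^ 2 + 2 * k * t + a) (k + t * c) c
      (by linear_combination h) rfl
    exact ⟨x, y + t * x, by linear_combination hxy⟩
  have sq_ne_two : k ^ 2 ≠ 2 := by
    intro hk
    have h₁ : k < 2 := by nlinarith
    have h₂ : -2 < k := by nlinarith
    interval_cases k <;> omega
  have ha : a ≠ 0 := by
    rintro rfl
    exact sq_ne_two (by linarith)
  have hc : c ≠ 0 := by
    rintro rfl
    exact sq_ne_two (by linarith)
  by_cases hak : a.natAbs < k.natAbs
  · by_cases hs : (k + 1 * a).natAbs < k.natAbs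
    · exact shift_left 1 hs
    · exact shift_left (-1) (by omega)
  by_cases hck : c.natAbs < k.natAbs
  · by_cases hs : (k + 1 * c).natAbs < k.natAbs
    · exact shift_right 1 hs
    · exact shift_right (-1) (by omega)
  have hka : |k| ≤ |a| := by
    simp only [Int.abs_eq_natAbs]
    omega
  have hkc : |k| ≤ |c| := by
    simp only [Int.abs_eq_natAbs]
    omega
  have hprod : k ^ 2 ≤ |a * c| := by
    rw [abs_mul, ← sq_abs, sq]
    exact mul_le_mul (hka) hkc (abs_nonneg _) (abs_nonneg _)
  have hk : k ^ 2 < 2 := by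
    rcases abs_cases (a * c) with ⟨h₁, h₂⟩ | ⟨h₁, h₂⟩ <;> linarith
  have hk₁ : k < 2 := by nlinarith
  have hk₂ : -2 < k := by nlinarith
  have ha_dvd : a ∣ k ^ 2 - 2 := ⟨c, by linarith⟩
  have ha_le : |a| ≤ 2 := by
    have := Int.le_of_dvd (by linarith) ((abs_dvd _ _).2 (dvd_neg.2 ha_dvd))
    nlinarith [sq_nonneg k]
  obtain ⟨ha₁, ha₂⟩ := abs_le.1 ha_le
  by_cases h₁ : a = -1
  · exact ⟨1, 0, by simp [h₁]⟩
  by_cases h₂ : c = -1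
  · exact ⟨0, 1, by simp [h₂]⟩
  refine ⟨1, 1, ?_⟩
  interval_cases k <;> interval_cases a <;> omega

/-- Every even binary lattice of discriminant `-8` represents `-2`. -/
theorem stmt7 (a b c : ℤ) (hD : b ^ 2 - 4 * a * c = 8) :
    ∃ x y : ℤ, 2 * a * x ^ 2 + 2 * b * x * y + 2 * c * y ^ 2 = -2 := by
  have hb : Even b := by
    have : Even (b ^ 2) := ⟨2 * a * c + 4, by linarith⟩
    exact (Int.even_pow.1 this).1
  obtain ⟨k, rfl⟩ := hb
  obtain ⟨x, y, hxy⟩ := represents_neg_one_of_sq_sub_mul_eq_two a k c (by linarith)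
  exact ⟨x, y, by linear_combination 2 * hxy⟩
end

section
/- Let α be an even integer with α ≥ 4. Then for all integers (x, y) ≠ (0, 0), the value α·x² + 4·x·y − α·y² is neither 0 nor −2. (That is, the even binary lattice !![α, 2; 2, −α], which has discriminant −(α² + 4), represents neither 0 nor −2 nontrivially.) -/
/-- A form value in `{-1, 0, 1}` forces the zero vector; the proof is a descent on `|y|` along the
two similitudes of norm `-1` of the form coming from the unit `k + √(k² + 1)`. -/
theorem eq_zero_of_abs_form_le_one {k : ℤ} (hk : 2 ≤ k) (x y : ℤ)
    (h : |k * x ^ 2 + 2 * x * y - k * y ^ 2| ≤ 1) : x = 0 ∧ y = 0 := by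
  by_cases hu : |k * x - (k - 1) * y| < |y|
  · have hu' : (k * x - (k - 1) * y).natAbs < y.natAbs := by zify; exact hu
    have ih := eq_zero_of_abs_form_le_one hk (-(k + 1) * x + k * y) (k * x - (k - 1) * y) (by
      rw [← abs_neg] at h
      convert h using 2
      ring)
    obtain ⟨h₁, h₂⟩ := ih
    constructor
    · linear_combination (k - 1) * h₁ + k * h₂
    · linear_combination k * h₁ + (k + 1) * h₂
  by_cases hv : |k * x + (k + 1) * y| < |y|
  · have hv' : (k * x + (k + 1) * y).natAbs < y.natAbs := by zify; exact hv
    have ih := eq_zero_of_abs_form_le_one hk ((k - 1) * x + k * y) (k * x + (k + 1) * y) (by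
      rw [← abs_neg] at h
      convert h using 2
      ring)
    obtain ⟨h₁, h₂⟩ := ih
    constructor
    · linear_combination -(k + 1) * h₁ + k * h₂
    · linear_combination k * h₁ - (k - 1) * h₂
  push Not at hu hv
  obtain ⟨c, hc⟩ : ∃ c, c = k * x ^ 2 + 2 * x * y - k * y ^ 2 := ⟨_, rfl⟩
  rw [← hc] at h
  obtain ⟨hc₁, hc₂⟩ := abs_le.mp h
  have hprod : |k * x - (k - 1) * y| * |k * x + (k + 1) * y| ≤ |y| ^ 2 + k := by
    rw [← abs_mul, sq_abs, abs_le]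
    have e : (k * x - (k - 1) * y) * (k * x + (k + 1) * y) = y ^ 2 + k * c := by
      rw [hc]; ring
    rw [e]
    constructor <;> nlinarith [sq_nonneg y]
  have hsum : 2 * k * |y| ≤ |k * x - (k - 1) * y| + |k * x + (k + 1) * y| := by
    have e : 2 * k * |y| = |(k * x + (k + 1) * y) - (k * x - (k - 1) * y)| := by
      rw [show (k * x + (k + 1) * y) - (k * x - (k - 1) * y) = (2 * k) * y by ring, abs_mul,
        abs_of_pos (by linarith : 0 < 2 * k)]
    rw [e, add_comm |k * x - (k - 1) * y|]
    simpa only [sub_eq_add_neg, abs_neg] using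
      abs_add_le (k * x + (k + 1) * y) (-(k * x - (k - 1) * y))
  have hy : |y| ≤ 1 := by
    by_contra! hy
    have hcorner := mul_nonneg (sub_nonneg.2 hu) (sub_nonneg.2 hv)
    nlinarith [mul_le_mul_of_nonneg_left hsum (abs_nonneg y)]
  have hX : (k * x + y) ^ 2 = (k ^ 2 + 1) * y ^ 2 + k * c := by rw [hc]; ring
  rcases eq_or_ne y 0 with rfl | hy0
  · refine ⟨?_, rfl⟩
    by_contra hx
    have : 0 < x ^ 2 := by positivity
    nlinarith
  · exfalso
    have hy2 : y ^ 2 = 1 := by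
      rw [← sq_abs, le_antisymm hy (Int.one_le_abs hy0), one_pow]
    rw [hy2, mul_one] at hX
    have hlo : k - 1 < |k * x + y| := by
      apply lt_of_pow_lt_pow_left₀ 2 (abs_nonneg _)
      rw [sq_abs, hX]
      nlinarith
    have hhi : |k * x + y| < k + 1 := by
      apply lt_of_pow_lt_pow_left₀ 2 (by linarith)
      rw [sq_abs, hX]
      nlinarith
    have heq : |k * x + y| = k := by lia
    rw [← sq_abs, heq] at hX
    have : k * c = -1 := by linarith
    have : k ∣ 1 := ⟨-c, by linarith⟩
    have := Int.le_of_dvd one_pos this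
    linarith
termination_by y.natAbs


/-- Anti-symplectic case, even `α ≥ 4`: the even lattice `!![α, 2; 2, -α]` of
discriminant `-(α² + 4)` represents neither `0` nor `-2` nontrivially. -/
theorem stmt9 (α : ℤ) (heven : Even α) (hα : 4 ≤ α) (x y : ℤ) (hxy : (x, y) ≠ (0, 0)) :
    α * x ^ 2 + 4 * x * y - α * y ^ 2 ≠ 0 ∧
      α * x ^ 2 + 4 * x * y - α * y ^ 2 ≠ -2 := by
  obtain ⟨k, rfl⟩ := heven
  have key := eq_zero_of_abs_form_le_one (k := k) (by linarith) x y
  constructor <;> intro h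
  · have hf : k * x ^ 2 + 2 * x * y - k * y ^ 2 = 0 := by linarith
    obtain ⟨rfl, rfl⟩ := key (by simp [hf])
    exact hxy rfl
  · have hf : k * x ^ 2 + 2 * x * y - k * y ^ 2 = -1 := by linarith
    obtain ⟨rfl, rfl⟩ := key (by simp [hf])
    exact hxy rfl
end

section
/- For every positive integer α, the following are equivalent: (i) α ≥ 4; (ii) there exist a positive integer β and integers a, b, c such that β²·(b² − 4ac) = α² − 4, b² − 4ac > 0, and for all integers (x, y) ≠ (0, 0) the value 2a·x² + 2b·x·y + 2c·y² is neither 0 nor −2. -/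
/-- Vieta jumping: `x² + y² + 1 = α x y` has no solution in positive integers if `4 ≤ α`. -/
theorem sq_add_sq_add_one_ne_mul {α : ℤ} (hα : 4 ≤ α) (n : ℕ) :
    ∀ x y : ℤ, 0 < x → 0 < y → x + y ≤ n → x ^ 2 + y ^ 2 + 1 ≠ α * x * y := by
  induction n with
  | zero => intro x y hx hy hn; push_cast at hn; omega
  | succ n ih =>
    intro x y hx hy hn h
    push_cast at hn
    wlog hxy : y ≤ x generalizing x y
    · exact this y x hy hx (by linarith) (by linarith) (by linarith)
    rcases hxy.eq_or_lt with rfl | hlt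
    · nlinarith [mul_pos hy hy]
    · have hprod : (α * y - x) * x = y ^ 2 + 1 := by linarith
      have hpos : 0 < α * y - x := by
        by_contra! hle
        nlinarith [mul_nonneg (neg_nonneg.2 hle) hx.le]
      have hsmall : α * y - x < x := by
        by_contra! hle
        nlinarith [mul_le_mul_of_nonneg_right hle hx.le]
      exact ih (α * y - x) y hpos hy (by omega) (by linarith)

theorem sq_add_mul_add_sq_ne_neg_one {α : ℤ} (hα : 4 ≤ α) (x y : ℤ) :
    x ^ 2 + α * x * y + y ^ 2 ≠ -1 := by
  intro h
  have hxy : x * y < 0 := by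
    by_contra! hle
    nlinarith [mul_nonneg (by omega : 0 ≤ α) hle, sq_nonneg x, sq_nonneg y]
  rcases mul_neg_iff.1 hxy with ⟨hx, hy⟩ | ⟨hx, hy⟩
  · exact sq_add_sq_add_one_ne_mul hα (x + -y).toNat x (-y) hx (by omega) (by omega) (by linarith)
  · exact sq_add_sq_add_one_ne_mul hα (-x + y).toNat (-x) y (by omega) hy (by omega) (by linarith)

theorem sq_add_mul_add_sq_ne_zero {α : ℤ} (hα : 4 ≤ α) {x y : ℤ} (hxy : (x, y) ≠ (0, 0)) :
    x ^ 2 + α * x * y + y ^ 2 ≠ 0 := by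
  intro h
  have hsq : (2 * x + α * y) ^ 2 = y ^ 2 * (α ^ 2 - 4) := by linarith
  rcases eq_or_ne y 0 with rfl | hy
  · simp_all
  · obtain ⟨k, hk⟩ := (Int.pow_dvd_pow_iff two_ne_zero).1 (Dvd.intro _ hsq.symm)
    have hk' : k ^ 2 = α ^ 2 - 4 := by
      apply mul_left_cancel₀ (pow_ne_zero 2 hy)
      rw [← hsq, hk, mul_pow]
    have hlt : |k| < α := abs_lt_of_sq_lt_sq (by omega) (by omega)
    have hgt : α - 1 < |k| := by
      apply lt_of_pow_lt_pow_left₀ 2 (abs_nonneg k)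
      rw [sq_abs]
      linarith
    omega

/-- Every integral binary quadratic form of discriminant `5` represents `-1`. -/
theorem exists_eq_neg_one_of_discrim_eq_five (n : ℕ) :
    ∀ a b c : ℤ, a.natAbs ≤ n → b ^ 2 - 4 * a * c = 5 →
      ∃ x y : ℤ, a * x ^ 2 + b * x * y + c * y ^ 2 = -1 := by
  have five_ne_sq (b : ℤ) : b ^ 2 ≠ 5 := by
    intro h
    have h₁ : b < 3 := by nlinarith
    have h₂ : -3 < b := by nlinarith
    interval_cases b <;> omega
  induction n with
  | zero =>
    intro a b c ha h
    obtain rfl : a = 0 := by omega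
    exact absurd (by linarith) (five_ne_sq b)
  | succ n ih =>
    intro a b c ha h
    have ha₀ : a ≠ 0 := by
      rintro rfl
      exact five_ne_sq b (by linarith)
    obtain ⟨k, hk⟩ : ∃ k : ℤ, |b + 2 * a * k| ≤ |a| := by
      refine ⟨-((b + |a|) / (2 * a)), ?_⟩
      have h₁ := Int.emod_nonneg (b + |a|) (mul_ne_zero two_ne_zero ha₀)
      have h₂ := Int.emod_lt_abs (b + |a|) (mul_ne_zero two_ne_zero ha₀)
      have h₃ := Int.emod_add_mul_ediv (b + |a|) (2 * a)
      rw [abs_mul, abs_two] at h₂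
      rw [abs_le]
      constructor <;> linarith
    set b' := b + 2 * a * k with hb'
    set c' := a * k ^ 2 + b * k + c with hc'
    have h' : b' ^ 2 - 4 * a * c' = 5 := by rw [hb', hc']; linarith
    suffices ∃ x y : ℤ, a * x ^ 2 + b' * x * y + c' * y ^ 2 = -1 by
      obtain ⟨x, y, hxy⟩ := this
      exact ⟨x + k * y, y, by rw [← hxy, hb', hc']; ring⟩
    have hc₀ : c' ≠ 0 := by
      intro hc
      rw [hc] at h'
      exact five_ne_sq b' (by linarith)
    have hb_sq : b' ^ 2 ≤ |a| ^ 2 := by rw [← sq_abs b']; gcongr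
    have hac : 4 * (|a| * |c'|) = |b' ^ 2 - 5| := by
      rw [← abs_mul, show b' ^ 2 - 5 = 4 * (a * c') by linarith, abs_mul 4]
      norm_num
    have ha_pos : 1 ≤ |a| := Int.one_le_abs ha₀
    have hc_pos : 1 ≤ |c'| := Int.one_le_abs hc₀
    rcases ha_pos.eq_or_lt with ha₁ | ha₁
    · rw [← ha₁] at hb_sq
      have hprod : a * c' = -1 := by
        have hsq := sq_nonneg b'
        rw [mul_assoc] at h'
        omega
      rcases Int.eq_one_or_neg_one_of_mul_eq_neg_one hprod with rfl | rfl
      · exact ⟨0, 1, by linarith⟩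
      · exact ⟨1, 0, by ring⟩
    · have hlt : |c'| < |a| := by
        by_contra! hle
        have hmul : |a| * |a| ≤ |a| * |c'| := by gcongr
        rcases abs_cases (b' ^ 2 - 5) with ⟨h₁, -⟩ | ⟨h₁, -⟩ <;>
          nlinarith [sq_nonneg b']
      have hlt' : c'.natAbs < a.natAbs := by
        zify
        exact hlt
      obtain ⟨x, y, hxy⟩ := ih c' b' a (by omega) (by linarith)
      exact ⟨y, x, by linarith⟩

/-- Symplectic case of Main Theorem: `A₊₁ = ℤ_{≥4}`. A positive integer `α` satisfies
`α ≥ 4` iff there are `β > 0` and an even binary lattice in `𝕃′` of discriminant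
`-(α² - 4)/β²`. -/
theorem stmt10 (α : ℤ) (hα : 0 < α) :
    4 ≤ α ↔
      ∃ β : ℤ, 0 < β ∧ ∃ a b c : ℤ,
        β ^ 2 * (b ^ 2 - 4 * a * c) = α ^ 2 - 4 ∧
        0 < b ^ 2 - 4 * a * c ∧
        ∀ x y : ℤ, (x, y) ≠ (0, 0) →
          2 * a * x ^ 2 + 2 * b * x * y + 2 * c * y ^ 2 ≠ 0 ∧
            2 * a * x ^ 2 + 2 * b * x * y + 2 * c * y ^ 2 ≠ -2 := by
  constructor
  · intro h
    refine ⟨1, one_pos, 1, α, 1, by ring, by nlinarith, fun x y hxy => ⟨fun h₀ => ?_, fun h₁ => ?_⟩⟩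
    · exact sq_add_mul_add_sq_ne_zero h hxy (by linarith)
    · exact sq_add_mul_add_sq_ne_neg_one h x y (by linarith)
  · rintro ⟨β, hβ, a, b, c, heq, hpos, hne⟩
    by_contra! hlt
    have hprod : 0 < β ^ 2 * (b ^ 2 - 4 * a * c) := by positivity
    have hα₃ : α = 3 := by
      interval_cases α <;> omega
    subst hα₃
    have hβ₁ : β = 1 := by
      have : β < 3 := by nlinarith
      interval_cases β <;> omega
    subst hβ₁
    obtain ⟨x, y, hxy⟩ :=
      exists_eq_neg_one_of_discrim_eq_five a.natAbs a b c le_rfl (by linarith)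
    refine (hne x y ?_).2 (by linarith)
    rintro ⟨⟩
    simp at hxy
end
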